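/- (Sands–Sauer–Woodrow theorem.) Let V be a nonempty type and let Eb and Er be binary relations on V. Assume that Eb admits no infinite path and that Er admits no infinite path. Then there exists a set S ⊆ V that is M-independent and such that every vertex x ∉ S satisfies M x s for some s ∈ S. -/

import Mathlib

/-- The asymmetric part of a binary relation. -/
def Asym {V : Type*} (R : V → V → Prop) : V → V → Prop :=
  fun x y => R x y ∧ ¬ R y x

/-- `f` is an infinite (outward) walk for `R`. -/
def InfWalk {V : Type*} (R : V → V → Prop) (f : ℕ → V) : Prop :=
  ∀ n : ℕ, R (f n) (f (n + 1))

/-- The monochromatic relation: union of the two transitive closures. -/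
def Mono {V : Type*} (Eb Er : V → V → Prop) : V → V → Prop :=
  fun x y => Relation.TransGen Eb x y ∨ Relation.TransGen Er x y

/-- `S` is `R`-independent. -/
def Indep {V : Type*} (R : V → V → Prop) (S : Set V) : Prop :=
  ∀ x ∈ S, ∀ y ∈ S, x = y ∨ ¬ R x y

/-- The order `≤_R` on subsets induced by a relation `R`. -/
def leR {V : Type*} (R : V → V → Prop) (S T : Set V) : Prop :=
  ∀ s ∈ S, ∃ t ∈ T, s = t ∨ R s t

/-- The collection `𝒮` of nonempty `M`-independent sets `S` such that every
vertex reachable from `S` by a red path reaches `S` by a monochromatic path. -/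
def Scal {V : Type*} (Eb Er : V → V → Prop) : Set (Set V) :=
  {S | S.Nonempty ∧ Indep (Mono Eb Er) S ∧
    ∀ y : V, (∃ s ∈ S, Relation.TransGen Er s y) → ∃ s' ∈ S, Mono Eb Er y s'}

/-- The set `S^∞_𝒞` associated to a collection `𝒞` of subsets. -/
def Sinf {V : Type*} (Eb : V → V → Prop) (C : Set (Set V)) : Set V :=
  {s | ∃ S ∈ C, ∀ U ∈ C, leR (Asym (Relation.TransGen Eb)) S U → s ∈ U}

open Relation

section Paths

variable {V : Type*} {R : V → V → Prop}

/-- A function that strictly decreases along a suitable outgoing edge at every vertex from which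
`t` is reachable. -/
theorem exists_descent_to_target (R : V → V → Prop) (t : V) :
    ∃ d : V → ℕ, ∀ v, ReflTransGen R v t → v ≠ t →
      ∃ w, R v w ∧ ReflTransGen R w t ∧ d w < d v := by
  let P : ℕ → V → Prop := fun n => n.rec (fun v => v = t) (fun _ Q v => ∃ w, R v w ∧ Q w)
  have reach_of_steps : ∀ n v, P n v → ReflTransGen R v t := by
    intro n
    induction n with
    | zero =>
      intro v h
      obtain h : v = t := h
      rw [h]
    | succ n ih => rintro v ⟨w, hvw, hw⟩; exact .head hvw (ih w hw)
  have steps_of_reach : ∀ v, ReflTransGen R v t → ∃ n, P n v := by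
    intro v h
    induction h using ReflTransGen.head_induction_on with
    | refl => exact ⟨0, rfl⟩
    | head hvw _ ih => obtain ⟨n, hn⟩ := ih; exact ⟨n + 1, _, hvw, hn⟩
  refine ⟨fun v => sInf {n | P n v}, fun v hv hne => ?_⟩
  have hmem : P (sInf {n | P n v}) v := Nat.sInf_mem (steps_of_reach v hv)
  rcases hn : sInf {n | P n v} with _ | m
  · rw [hn] at hmem
    exact absurd hmem hne
  · rw [hn] at hmem
    obtain ⟨w, hvw, hw⟩ := hmem
    refine ⟨w, hvw, reach_of_steps m w hw, ?_⟩
    have hle : sInf {n | P n w} ≤ m := Nat.sInf_le hw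
    change sInf {n | P n w} < sInf {n | P n v}
    lia

/-- An infinite walk for the strict part of the transitive closure yields an infinite path. -/
theorem InfWalk.exists_injective {a : ℕ → V} (ha : InfWalk (Asym (TransGen R)) a) :
    ∃ f : ℕ → V, InfWalk R f ∧ Function.Injective f := by
  have reach : ∀ {i j}, i ≤ j → ReflTransGen R (a i) (a j) := by
    intro i j hij
    induction hij with
    | refl => exact .refl
    | step _ ih => exact ih.trans (ha _).1.to_reflTransGen
  have not_back : ∀ i, ¬ ReflTransGen R (a (i + 1)) (a i) := by
    intro i h
    rcases reflTransGen_iff_eq_or_transGen.mp h with h | h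
    · have h' := ha i
      rw [← h] at h'
      exact h'.2 h'.1
    · exact (ha i).2 h
  choose d hd using fun k => exists_descent_to_target R (a k)
  -- the first index whose vertex does not reach `v`
  let t : V → ℕ := fun v => sInf {k | ¬ ReflTransGen R (a k) v}
  have t_spec : ∀ v k, ReflTransGen R v (a k) → ¬ ReflTransGen R (a (t v)) v := by
    intro v k h
    exact Nat.sInf_mem (s := {k | ¬ ReflTransGen R (a k) v})
      ⟨k + 1, fun h' => not_back k (h'.trans h)⟩
  have t_mono : ∀ v w k, R v w → ReflTransGen R w (a k) → t v ≤ t w := fun v w k h hw =>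
    Nat.sInf_le fun h' => t_spec w k hw (h'.tail h)
  let W := {v : V // ReflTransGen R v (a (t v))}
  let μ : W → ℕ ×ₗ ℕᵒᵈ := fun v => toLex (t v, OrderDual.toDual (d (t v) v))
  have step : ∀ v : W, ∃ w : W, R v w ∧ μ v < μ w := by
    rintro ⟨v, hv⟩
    have hne : v ≠ a (t v) := by
      intro h
      apply t_spec v _ hv
      rw [← h]
    obtain ⟨w, hvw, hw, hlt⟩ := hd (t v) v hv hne
    have hle := t_mono v w _ hvw hw
    refine ⟨⟨w, hw.trans (reach hle)⟩, hvw, ?_⟩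
    rw [Prod.Lex.toLex_lt_toLex]
    rcases hle.lt_or_eq with h | h
    · exact .inl h
    · refine .inr ⟨h, ?_⟩
      rw [OrderDual.toDual_lt_toDual]
      simp only [← h]
      exact hlt
  choose next hnext hμ using step
  let start : W := ⟨a 0, reach (Nat.zero_le _)⟩
  let g : ℕ → W := fun n => next^[n] start
  have g_succ : ∀ n, g (n + 1) = next (g n) := fun n => Function.iterate_succ_apply' _ _ _
  have g_mono : StrictMono (μ ∘ g) := strictMono_nat_of_lt_succ fun n => by
    simp only [Function.comp, g_succ]
    exact hμ _
  refine ⟨fun n => g n, fun n => ?_, ?_⟩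
  · simp only [g_succ]
    exact hnext _
  · exact Subtype.val_injective.comp g_mono.injective.of_comp

theorem wellFounded_swap_asym_transGen
    (h : ¬ ∃ f : ℕ → V, InfWalk R f ∧ Function.Injective f) :
    WellFounded (Function.swap (Asym (TransGen R))) :=
  wellFounded_iff_isEmpty_descending_chain.mpr ⟨fun ⟨_, ha⟩ => h (InfWalk.exists_injective ha)⟩

end Paths

section Order

variable {V : Type*} {R : V → V → Prop}

theorem Asym.trans (hR : ∀ {x y z}, R x y → R y z → R x z) {x y z : V}
    (hxy : Asym R x y) (hyz : Asym R y z) : Asym R x z :=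
  ⟨hR hxy.1 hyz.1, fun h => hxy.2 (hR hyz.1 h)⟩

theorem leR.refl (S : Set V) : leR R S S := fun s hs => ⟨s, hs, .inl rfl⟩

theorem leR.trans (hR : ∀ {x y z}, R x y → R y z → R x z) {S T U : Set V}
    (hST : leR R S T) (hTU : leR R T U) : leR R S U := by
  intro s hs
  obtain ⟨t, ht, hst⟩ := hST s hs
  obtain ⟨u, hu, htu⟩ := hTU t ht
  refine ⟨u, hu, ?_⟩
  rcases hst with rfl | hst
  · exact htu
  · rcases htu with rfl | htu
    · exact .inr hst
    · exact .inr (hR hst htu)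

end Order

section Kernel

variable {V : Type*} {Eb Er : V → V → Prop}

theorem leR_Sinf (hb : WellFounded (Function.swap (Asym (TransGen Eb))))
    {C : Set (Set V)} {S : Set V} (hS : S ∈ C) :
    leR (Asym (TransGen Eb)) S (Sinf Eb C) := by
  intro s
  induction s using hb.induction generalizing S with
  | _ s ih =>
    intro hs
    by_cases hmem : s ∈ Sinf Eb C
    · exact ⟨s, hmem, .inl rfl⟩
    have : ∃ U ∈ C, leR (Asym (TransGen Eb)) S U ∧ s ∉ U := by
      by_contra! h
      exact hmem ⟨S, hS, h⟩
    obtain ⟨U, hU, hSU, hsU⟩ := this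
    obtain ⟨u, hu, rfl | hsu⟩ := hSU s hs
    · exact absurd hu hsU
    obtain ⟨t, ht, hut⟩ := ih u hsu hU hu
    refine ⟨t, ht, .inr ?_⟩
    rcases hut with rfl | hut
    · exact hsu
    · exact hsu.trans TransGen.trans hut

theorem Sinf_mem_Scal (hb : WellFounded (Function.swap (Asym (TransGen Eb))))
    {C : Set (Set V)} (hC : C ⊆ Scal Eb Er) (hne : C.Nonempty)
    (hchain : ∀ S ∈ C, ∀ T ∈ C,
      leR (Asym (TransGen Eb)) S T ∨ leR (Asym (TransGen Eb)) T S) :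
    Sinf Eb C ∈ Scal Eb Er := by
  refine ⟨?_, ?_, ?_⟩
  · obtain ⟨S, hS⟩ := hne
    obtain ⟨s, hs⟩ := (hC hS).1
    obtain ⟨t, ht, -⟩ := leR_Sinf hb hS s hs
    exact ⟨t, ht⟩
  · rintro x ⟨S, hS, hxS⟩ y ⟨T, hT, hyT⟩
    rcases hchain S hS T hT with h | h
    · exact (hC hT).2.1 x (hxS T hT h) y (hyT T hT (leR.refl T))
    · exact (hC hS).2.1 x (hxS S hS (leR.refl S)) y (hyT S hS h)
  · rintro y ⟨s, ⟨S, hS, hsS⟩, hsy⟩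
    have hs : s ∈ S := hsS S hS (leR.refl S)
    obtain ⟨u, hu, hyu | hyu⟩ := (hC hS).2.2 y ⟨s, hs, hsy⟩
    · obtain ⟨t, ht, rfl | hut⟩ := leR_Sinf hb hS u hu
      · exact ⟨u, ht, .inl hyu⟩
      · exact ⟨t, ht, .inl (hyu.trans hut.1)⟩
    · obtain rfl | h := (hC hS).2.1 s hs u hu
      · exact ⟨s, ⟨S, hS, hsS⟩, .inr hyu⟩
      · exact absurd (.inr (hsy.trans hyu)) h

theorem Scal_nonempty [Nonempty V] (hr : WellFounded (Function.swap (Asym (TransGen Er)))) :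
    (Scal Eb Er).Nonempty := by
  obtain ⟨x, -, hx⟩ := hr.has_min Set.univ Set.univ_nonempty
  refine ⟨{x}, ⟨x, rfl⟩, ?_, ?_⟩
  · rintro _ rfl _ rfl
    exact .inl rfl
  · rintro y ⟨_, rfl, hxy⟩
    refine ⟨_, rfl, .inr ?_⟩
    by_contra h
    exact hx y trivial ⟨hxy, h⟩

theorem exists_maximal_Scal [Nonempty V]
    (hb : WellFounded (Function.swap (Asym (TransGen Eb))))
    (hr : WellFounded (Function.swap (Asym (TransGen Er)))) :
    ∃ S ∈ Scal Eb Er, ∀ T ∈ Scal Eb Er,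
      leR (Asym (TransGen Eb)) S T → leR (Asym (TransGen Eb)) T S := by
  obtain ⟨S₀, hS₀⟩ := Scal_nonempty (Eb := Eb) hr
  obtain ⟨⟨S, hS⟩, hmax⟩ := exists_maximal_of_chains_bounded
    (r := fun S T : Scal Eb Er => leR (Asym (TransGen Eb)) S.1 T.1)
    (fun C hC => by
      rcases C.eq_empty_or_nonempty with rfl | hne
      · exact ⟨⟨S₀, hS₀⟩, by simp⟩
      · refine ⟨⟨Sinf Eb (Subtype.val '' C), Sinf_mem_Scal hb ?_ (hne.image _) ?_⟩, ?_⟩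
        · rintro _ ⟨S, -, rfl⟩
          exact S.2
        · rintro _ ⟨S, hS, rfl⟩ _ ⟨T, hT, rfl⟩
          by_cases h : S = T
          · exact .inl (h ▸ leR.refl _)
          · exact hC hS hT h
        · exact fun S hS => leR_Sinf hb ⟨S, hS, rfl⟩)
    (fun h h' => h.trans (Asym.trans TransGen.trans) h')
  exact ⟨S, hS, fun T hT => hmax ⟨T, hT⟩⟩

/-- If `x` does not reach `S` monochromatically and is red-maximal with that property, then
replacing the vertices of `S` with a blue path to `x` by `x` itself stays within `Scal`. -/
theorem insert_mem_Scal {S : Set V} (hS : S ∈ Scal Eb Er) {x : V}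
    (hxS : ∀ s ∈ S, ¬ Mono Eb Er x s)
    (hx : ∀ y, y ∉ S → (∀ s ∈ S, ¬ Mono Eb Er y s) → TransGen Er x y → TransGen Er y x) :
    insert x {s ∈ S | ¬ TransGen Eb s x} ∈ Scal Eb Er := by
  obtain ⟨-, hind, hred⟩ := hS
  refine ⟨⟨x, .inl rfl⟩, ?_, ?_⟩
  · have key : ∀ s ∈ S, ¬ TransGen Eb s x → ¬ Mono Eb Er s x := by
      rintro s hs hsx (h | h)
      · exact hsx h
      · obtain ⟨s', hs', h'⟩ := hred x ⟨s, hs, h⟩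
        exact hxS s' hs' h'
    rintro u (rfl | ⟨hu, hux⟩) v (rfl | ⟨hv, hvx⟩)
    · exact .inl rfl
    · exact .inr (hxS v hv)
    · exact .inr (key u hu hux)
    · exact hind u hu v hv
  · have blue : ∀ y, ∀ s ∈ S, TransGen Eb y s →
        ∃ t ∈ insert x {s ∈ S | ¬ TransGen Eb s x}, Mono Eb Er y t := by
      intro y s hs hys
      by_cases hsx : TransGen Eb s x
      · exact ⟨x, .inl rfl, .inl (hys.trans hsx)⟩
      · exact ⟨s, .inr ⟨hs, hsx⟩, .inl hys⟩
    rintro y ⟨t, rfl | ⟨ht, htx⟩, hty⟩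
    · by_cases hyS : ∃ s ∈ S, Mono Eb Er y s
      · obtain ⟨s, hs, h | h⟩ := hyS
        · exact blue y s hs h
        · exact absurd (.inr (hty.trans h)) (hxS s hs)
      · push Not at hyS
        exact ⟨t, .inl rfl, .inr (hx y (fun h => hxS y h (.inr hty)) hyS hty)⟩
    · obtain ⟨s, hs, h | h⟩ := hred y ⟨t, ht, hty⟩
      · exact blue y s hs h
      · obtain rfl | h' := hind t ht s hs
        · exact ⟨t, .inr ⟨ht, htx⟩, .inr h⟩
        · exact absurd (.inr (hty.trans h)) h'

end Kernel

theorem stmt1 {V : Type*} [Nonempty V] (Eb Er : V → V → Prop)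
    (hb : ¬ ∃ f : ℕ → V, InfWalk Eb f ∧ Function.Injective f)
    (hr : ¬ ∃ f : ℕ → V, InfWalk Er f ∧ Function.Injective f) :
    ∃ S : Set V, Indep (Mono Eb Er) S ∧
      ∀ x : V, x ∉ S → ∃ s ∈ S, Mono Eb Er x s := by
  have hr' := wellFounded_swap_asym_transGen hr
  obtain ⟨S, hS, hmax⟩ := exists_maximal_Scal (wellFounded_swap_asym_transGen hb) hr'
  refine ⟨S, hS.2.1, ?_⟩
  by_contra! hX
  obtain ⟨x, ⟨hx, hxS⟩, hxmax⟩ :=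
    hr'.has_min {x | x ∉ S ∧ ∀ s ∈ S, ¬ Mono Eb Er x s} hX
  have hT := insert_mem_Scal hS hxS fun y hy hyS hxy => by
    by_contra h
    exact hxmax y ⟨hy, hyS⟩ ⟨hxy, h⟩
  obtain ⟨s, hs, rfl | hxs⟩ := hmax _ hT (fun s hs => by
    by_cases hsx : TransGen Eb s x
    · exact ⟨x, .inl rfl, .inr ⟨hsx, fun h => hxS s hs (.inl h)⟩⟩
    · exact ⟨s, .inr ⟨hs, hsx⟩, .inl rfl⟩) x (.inl rfl)
  · exact hx hs
  · exact hxS s hs (.inl hxs.1)
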